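/- Let E be a real inner product space and let ε > 0 satisfy e^{2ε} − 1 ≤ 4ε. Let d be a metric on E such that e^{−ε/2}·‖p−q‖ ≤ d(p,q) ≤ e^{ε/2}·‖p−q‖ for all p,q ∈ E. Then for all x, y ∈ E and every point z ∈ E lying on a d-geodesic from x to y, i.e. satisfying d(x,z) + d(z,y) = d(x,y), the distance from z to the segment [x,y] = {(1−t)·x + t·y : t ∈ [0,1]} satisfies infDist(z, [x,y]) ≤ √ε·‖x−y‖. -/

import Mathlib

/-- Stewart's theorem in an inner product space: the squared distance from `z` to the point
dividing the segment from `x` to `y` in the ratio `t : 1 - t`. -/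
theorem norm_sub_convexComb_sq {E : Type*} [NormedAddCommGroup E] [InnerProductSpace ℝ E]
    (x y z : E) (t : ℝ) :
    ‖z - ((1 - t) • x + t • y)‖ ^ 2 =
      (1 - t) * ‖x - z‖ ^ 2 + t * ‖z - y‖ ^ 2 - t * (1 - t) * ‖x - y‖ ^ 2 := by
  have hw : z - ((1 - t) • x + t • y) = t • (z - y) - (1 - t) • (x - z) := by module
  have hxy : x - y = (x - z) + (z - y) := by abel
  rw [hw, hxy, norm_sub_sq_real, norm_add_sq_real, norm_smul, norm_smul, inner_smul_left,
    inner_smul_right, mul_pow, mul_pow, Real.norm_eq_abs, Real.norm_eq_abs, sq_abs, sq_abs,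
    real_inner_comm (x - z) (z - y)]
  simp only [conj_trivial]
  ring

/-- A point whose distances to the endpoints of a segment have sum `s` is at distance at most
`√(s² - ‖x - y‖²) / 2` from the segment. -/
theorem four_mul_infDist_segment_sq_le {E : Type*} [NormedAddCommGroup E]
    [InnerProductSpace ℝ E] (x y z : E) :
    4 * Metric.infDist z (segment ℝ x y) ^ 2 ≤ (‖x - z‖ + ‖z - y‖) ^ 2 - ‖x - y‖ ^ 2 := by
  have htri : ‖x - y‖ ≤ ‖x - z‖ + ‖z - y‖ := norm_sub_le_norm_sub_add_norm_sub x z y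
  have ha := norm_nonneg (x - z)
  have hb := norm_nonneg (z - y)
  have hsq : 0 ≤ (‖x - z‖ + ‖z - y‖) ^ 2 - ‖x - y‖ ^ 2 :=
    sub_nonneg.2 (pow_le_pow_left₀ (norm_nonneg _) htri 2)
  obtain ⟨t, ht0, ht1, ht⟩ :
      ∃ t : ℝ, 0 ≤ t ∧ t ≤ 1 ∧ ‖x - z‖ = t * (‖x - z‖ + ‖z - y‖) := by
    rcases (add_nonneg ha hb).eq_or_lt with hs | hs
    · exact ⟨0, le_rfl, zero_le_one, by linarith⟩
    · exact ⟨‖x - z‖ / (‖x - z‖ + ‖z - y‖), by positivity,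
        (div_le_one hs).2 (by linarith), (div_mul_cancel₀ _ hs.ne').symm⟩
  have hmem : (1 - t) • x + t • y ∈ segment ℝ x y :=
    ⟨1 - t, t, by linarith, ht0, by ring, rfl⟩
  have hle := Metric.infDist_le_dist_of_mem (x := z) hmem
  rw [dist_eq_norm] at hle
  have hdist := pow_le_pow_left₀ Metric.infDist_nonneg hle 2
  rw [norm_sub_convexComb_sq] at hdist
  set s := ‖x - z‖ + ‖z - y‖ with hs
  have hzy : ‖z - y‖ = (1 - t) * s := by linarith
  rw [ht, hzy] at hdist
  nlinarith [mul_nonneg (sq_nonneg (2 * t - 1)) hsq]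


/-- Flat case of Proposition 5.2: if `d` is a metric on a real inner product
space `E` with `e^{-ε/2} ‖p - q‖ ≤ d p q ≤ e^{ε/2} ‖p - q‖` and
`e^{2ε} - 1 ≤ 4ε`, then any point `z` on a `d`-geodesic from `x` to `y`
(i.e. with `d x z + d z y = d x y`) lies within distance `√ε · ‖x - y‖` of the
straight segment `[x, y]`. -/
theorem dGeodesic_close_to_segment
    {E : Type*} [NormedAddCommGroup E] [InnerProductSpace ℝ E]
    (ε : ℝ) (hε : 0 < ε) (hε' : Real.exp (2 * ε) - 1 ≤ 4 * ε)
    (d : E → E → ℝ)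
    (hd_self : ∀ p, d p p = 0)
    (hd_symm : ∀ p q, d p q = d q p)
    (hd_tri : ∀ p q r, d p r ≤ d p q + d q r)
    (hd_eq : ∀ p q, d p q = 0 → p = q)
    (hlow : ∀ p q, Real.exp (-(ε / 2)) * ‖p - q‖ ≤ d p q)
    (hhigh : ∀ p q, d p q ≤ Real.exp (ε / 2) * ‖p - q‖)
    (x y z : E) (hz : d x z + d z y = d x y) :
    Metric.infDist z (segment ℝ x y) ≤ Real.sqrt ε * ‖x - y‖ := by
  have hsum : ‖x - z‖ + ‖z - y‖ ≤ Real.exp ε * ‖x - y‖ := by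
    have h : Real.exp (-(ε / 2)) * (‖x - z‖ + ‖z - y‖) ≤ Real.exp (ε / 2) * ‖x - y‖ := by
      linarith [hlow x z, hlow z y, hhigh x y]
    have h' := mul_le_mul_of_nonneg_left h (Real.exp_pos (ε / 2)).le
    rwa [← mul_assoc, ← mul_assoc, ← Real.exp_add, ← Real.exp_add, add_neg_cancel,
      Real.exp_zero, one_mul, add_halves] at h'
  have hsum_sq := pow_le_pow_left₀ (by positivity) hsum 2
  have hexp : Real.exp ε ^ 2 = Real.exp (2 * ε) := by
    rw [← Real.exp_nat_mul, Nat.cast_ofNat]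
  rw [mul_pow, hexp] at hsum_sq
  refine (pow_le_pow_iff_left₀ Metric.infDist_nonneg (by positivity) two_ne_zero).1 ?_
  rw [mul_pow, Real.sq_sqrt hε.le]
  nlinarith [four_mul_infDist_segment_sq_le x y z,
    mul_le_mul_of_nonneg_right hε' (sq_nonneg ‖x - y‖)]
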